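/- arXiv:2508.08644 — 5 statements merged into one kernel-verified Lean document; each statement's English description precedes it below -/
import Mathlib

section
/- Let p be a probability vector on Fin a × Fin b × Fin c with coordinates (X, Y, Z), and let pY denote the Y-marginal. Then I(X;Z) ≤ H(pY) + I(X;Z|Y). (This is the corrected form of the paper's key inequality I(θ;S) ≤ H(M) + ε with ε = I(θ;S|M), obtained by combining monotonicity of mutual information, the chain rule I((X,Y);Z) = I(Y;Z) + I(X;Z|Y), and the bound I(Y;Z) ≤ H(Y).) -/
open scoped Classical

/-- `X`-marginal of a probability vector on `Fin a × Fin b × Fin c` with coordinates `(X, Y, Z)`. -/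
noncomputable def margX {a b c : ℕ} (p : Fin a × Fin b × Fin c → ℝ) (x : Fin a) : ℝ :=
  ∑ y, ∑ z, p (x, y, z)

/-- `Y`-marginal. -/
noncomputable def margY {a b c : ℕ} (p : Fin a × Fin b × Fin c → ℝ) (y : Fin b) : ℝ :=
  ∑ x, ∑ z, p (x, y, z)

/-- `Z`-marginal. -/
noncomputable def margZ {a b c : ℕ} (p : Fin a × Fin b × Fin c → ℝ) (z : Fin c) : ℝ :=
  ∑ x, ∑ y, p (x, y, z)

/-- `(X, Y)`-marginal. -/
noncomputable def margXY {a b c : ℕ} (p : Fin a × Fin b × Fin c → ℝ) (x : Fin a) (y : Fin b) : ℝ :=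
  ∑ z, p (x, y, z)

/-- `(Y, Z)`-marginal. -/
noncomputable def margYZ {a b c : ℕ} (p : Fin a × Fin b × Fin c → ℝ) (y : Fin b) (z : Fin c) : ℝ :=
  ∑ x, p (x, y, z)

/-- `(X, Z)`-marginal. -/
noncomputable def margXZ {a b c : ℕ} (p : Fin a × Fin b × Fin c → ℝ) (x : Fin a) (z : Fin c) : ℝ :=
  ∑ y, p (x, y, z)

/-- Shannon entropy of a function on a finite type, `H(f) = ∑ x, -(f x) * log (f x)`. -/
noncomputable def shEnt {α : Type*} [Fintype α] (f : α → ℝ) : ℝ :=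
  ∑ x, Real.negMulLog (f x)

/-- Conditional entropy `H(X|Y)`. -/
noncomputable def condEntXgY {a b c : ℕ} (p : Fin a × Fin b × Fin c → ℝ) : ℝ :=
  ∑ u ∈ Finset.univ.filter (fun u : Fin a × Fin b => 0 < margXY p u.1 u.2),
    margXY p u.1 u.2 * Real.log (margY p u.2 / margXY p u.1 u.2)

/-- Conditional entropy `H(Z|Y)`. -/
noncomputable def condEntZgY {a b c : ℕ} (p : Fin a × Fin b × Fin c → ℝ) : ℝ :=
  ∑ u ∈ Finset.univ.filter (fun u : Fin b × Fin c => 0 < margYZ p u.1 u.2),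
    margYZ p u.1 u.2 * Real.log (margY p u.1 / margYZ p u.1 u.2)

/-- Conditional joint entropy `H(X,Z|Y)`. -/
noncomputable def condEntXZgY {a b c : ℕ} (p : Fin a × Fin b × Fin c → ℝ) : ℝ :=
  ∑ u ∈ Finset.univ.filter (fun u : Fin a × Fin b × Fin c => 0 < p u),
    p u * Real.log (margY p u.2.1 / p u)

/-- Conditional mutual information `I(X;Z|Y) = H(X|Y) + H(Z|Y) − H(X,Z|Y)`. -/
noncomputable def condMI_XZgY {a b c : ℕ} (p : Fin a × Fin b × Fin c → ℝ) : ℝ :=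
  condEntXgY p + condEntZgY p - condEntXZgY p

/-- Mutual information between the pair `(X, Y)` and `Z`:
`I((X,Y);Z) = H(pXY) + H(pZ) − H(p)`. -/
noncomputable def miXY_Z {a b c : ℕ} (p : Fin a × Fin b × Fin c → ℝ) : ℝ :=
  shEnt (fun u : Fin a × Fin b => margXY p u.1 u.2) + shEnt (margZ p) - shEnt p

/-- Mutual information of the `(Y, Z)`-marginal: `I(Y;Z) = H(pY) + H(pZ) − H(pYZ)`. -/
noncomputable def miY_Z {a b c : ℕ} (p : Fin a × Fin b × Fin c → ℝ) : ℝ :=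
  shEnt (margY p) + shEnt (margZ p) - shEnt (fun u : Fin b × Fin c => margYZ p u.1 u.2)

/-- Mutual information of the `(X, Z)`-marginal: `I(X;Z) = H(pX) + H(pZ) − H(pXZ)`. -/
noncomputable def miX_Z {a b c : ℕ} (p : Fin a × Fin b × Fin c → ℝ) : ℝ :=
  shEnt (margX p) + shEnt (margZ p) - shEnt (fun u : Fin a × Fin c => margXZ p u.1 u.2)

open Finset Real

/-- Entropy of a nonnegative finite family grows when the family is refined. -/
lemma negMulLog_sum_le {ι : Type*} [Fintype ι] (f : ι → ℝ) (hf : ∀ i, 0 ≤ f i) :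
    negMulLog (∑ i, f i) ≤ ∑ i, negMulLog (f i) := by
  rw [negMulLog, ← sum_neg_distrib, sum_mul]
  refine sum_le_sum fun i _ => ?_
  rcases (hf i).eq_or_lt with h | h
  · simp [← h]
  · have hlog := log_le_log h (single_le_sum (fun j _ => hf j) (mem_univ i))
    rw [negMulLog]
    nlinarith

/-- Subadditivity of the entropy, for nonnegative matrices of arbitrary total mass. -/
lemma negMulLog_sum_add_sum_negMulLog_le {β γ : Type*} [Fintype β] [Fintype γ]
    (g : β → γ → ℝ) (hg : ∀ y z, 0 ≤ g y z) :
    negMulLog (∑ y, ∑ z, g y z) + ∑ y, ∑ z, negMulLog (g y z) ≤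
      ∑ y, negMulLog (∑ z, g y z) + ∑ z, negMulLog (∑ y, g y z) := by
  set r : β → ℝ := fun y => ∑ z, g y z
  set s : γ → ℝ := fun z => ∑ y, g y z
  set t : ℝ := ∑ y, r y
  have hst : ∑ z, s z = t := sum_comm
  have hr0 : ∀ y, 0 ≤ r y := fun y => sum_nonneg fun z _ => hg y z
  have hs0 : ∀ z, 0 ≤ s z := fun z => sum_nonneg fun y _ => hg y z
  have ht0 : 0 ≤ t := sum_nonneg fun y _ => hr0 y
  have pointwise : ∀ y z, g y z - r y * s z / t ≤
      g y z * (log (g y z) + log t - log (r y) - log (s z)) := by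
    intro y z
    rcases (hg y z).eq_or_lt with h | h
    · have : 0 ≤ r y * s z / t := div_nonneg (mul_nonneg (hr0 y) (hs0 z)) ht0
      simp only [← h, zero_mul]
      linarith
    · have hry : 0 < r y := h.trans_le (single_le_sum (fun j _ => hg y j) (mem_univ z))
      have hsz : 0 < s z :=
        h.trans_le (single_le_sum (f := fun j => g j z) (fun j _ => hg j z) (mem_univ y))
      have htp : 0 < t := hry.trans_le (single_le_sum (fun j _ => hr0 j) (mem_univ y))
      have hlog := log_le_sub_one_of_pos (x := r y * s z / (t * g y z)) (by positivity)
      rw [log_div (by positivity) (by positivity), log_mul hry.ne' hsz.ne',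
        log_mul htp.ne' h.ne'] at hlog
      have hmul := mul_le_mul_of_nonneg_left hlog h.le
      have hcancel : g y z * (r y * s z / (t * g y z) - 1) = r y * s z / t - g y z := by
        field_simp
      rw [hcancel] at hmul
      linarith
  have hsum := sum_le_sum fun y (_ : y ∈ univ) => sum_le_sum fun z (_ : z ∈ univ) => pointwise y z
  have hzero : ∑ y, ∑ z, (g y z - r y * s z / t) = 0 := by
    simp only [sum_sub_distrib, ← sum_div, ← mul_sum, ← sum_mul, hst]
    change t - t * t / t = 0
    rw [mul_self_div_self, sub_self]
  have hexpand : ∑ y, ∑ z, g y z * (log (g y z) + log t - log (r y) - log (s z)) =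
      -(∑ y, ∑ z, negMulLog (g y z)) - negMulLog t + ∑ y, negMulLog (r y)
        + ∑ z, negMulLog (s z) := by
    have h1 : ∑ y, ∑ z, g y z * log t = -negMulLog t := by
      simp only [← sum_mul, negMulLog, neg_mul, neg_neg]
      rfl
    have h2 : ∑ y, ∑ z, g y z * log (r y) = -∑ y, negMulLog (r y) := by
      simp only [← sum_mul, negMulLog, neg_mul, sum_neg_distrib, neg_neg]
      rfl
    have h3 : ∑ y, ∑ z, g y z * log (s z) = -∑ z, negMulLog (s z) := by
      rw [sum_comm]
      simp only [← sum_mul, negMulLog, neg_mul, sum_neg_distrib, neg_neg]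
      rfl
    simp only [mul_sub, mul_add, sum_sub_distrib, sum_add_distrib, h1, h2, h3]
    simp only [negMulLog, neg_mul, sum_neg_distrib]
    ring
  linarith

/-- The support restriction in a conditional entropy is harmless. -/
lemma sum_pos_mul_log_div {ι : Type*} [Fintype ι] (h m : ι → ℝ) (h0 : ∀ i, 0 ≤ h i)
    (hm : ∀ i, h i ≤ m i) :
    ∑ i ∈ univ.filter (fun i => 0 < h i), h i * log (m i / h i) =
      ∑ i, negMulLog (h i) + ∑ i, h i * log (m i) := by
  rw [sum_filter, ← sum_add_distrib]
  refine sum_congr rfl fun i _ => ?_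
  split_ifs with hi
  · rw [log_div (hi.trans_le (hm i)).ne' hi.ne', negMulLog]
    ring
  · simp [le_antisymm (not_lt.mp hi) (h0 i)]

section Marginals

variable {a b c : ℕ} {p : Fin a × Fin b × Fin c → ℝ}

lemma margXY_nonneg (hp0 : ∀ u, 0 ≤ p u) (x : Fin a) (y : Fin b) : 0 ≤ margXY p x y :=
  sum_nonneg fun _ _ => hp0 _

lemma margYZ_nonneg (hp0 : ∀ u, 0 ≤ p u) (y : Fin b) (z : Fin c) : 0 ≤ margYZ p y z :=
  sum_nonneg fun _ _ => hp0 _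

lemma sum_margYZ (p : Fin a × Fin b × Fin c → ℝ) (y : Fin b) :
    ∑ z, margYZ p y z = margY p y := sum_comm

lemma condEntXgY_eq (hp0 : ∀ u, 0 ≤ p u) :
    condEntXgY p =
      shEnt (fun u : Fin a × Fin b => margXY p u.1 u.2) - shEnt (margY p) := by
  rw [condEntXgY, sum_pos_mul_log_div (fun u : Fin a × Fin b => margXY p u.1 u.2)
    (fun u => margY p u.2) (fun u => margXY_nonneg hp0 _ _)
    (fun u => single_le_sum (f := fun x => margXY p x u.2)
      (fun x _ => margXY_nonneg hp0 x _) (mem_univ u.1)), Fintype.sum_prod_type_right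
    (f := fun u : Fin a × Fin b => margXY p u.1 u.2 * log (margY p u.2))]
  simp only [← sum_mul, shEnt, negMulLog, neg_mul, sum_neg_distrib, sub_neg_eq_add]
  rfl

lemma condEntZgY_eq (hp0 : ∀ u, 0 ≤ p u) :
    condEntZgY p =
      shEnt (fun u : Fin b × Fin c => margYZ p u.1 u.2) - shEnt (margY p) := by
  rw [condEntZgY, sum_pos_mul_log_div (fun u : Fin b × Fin c => margYZ p u.1 u.2)
    (fun u => margY p u.1) (fun u => margYZ_nonneg hp0 _ _)
    (fun u => by
      rw [← sum_margYZ]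
      exact single_le_sum (fun z _ => margYZ_nonneg hp0 _ z) (mem_univ u.2)),
    Fintype.sum_prod_type (f := fun u : Fin b × Fin c => margYZ p u.1 u.2 * log (margY p u.1))]
  simp only [← sum_mul, sum_margYZ, shEnt, negMulLog, neg_mul, sum_neg_distrib, sub_neg_eq_add]

lemma condEntXZgY_eq (hp0 : ∀ u, 0 ≤ p u) :
    condEntXZgY p = shEnt p - shEnt (margY p) := by
  rw [condEntXZgY, sum_pos_mul_log_div p (fun u => margY p u.2.1) hp0 (fun u =>
    (single_le_sum (f := fun z => p (u.1, u.2.1, z)) (fun z _ => hp0 _) (mem_univ u.2.2)).trans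
      (single_le_sum (f := fun x => margXY p x u.2.1)
        (fun x _ => margXY_nonneg hp0 x _) (mem_univ u.1)))]
  have hsum : ∑ u, p u * log (margY p u.2.1) = ∑ y, margY p y * log (margY p y) := by
    simp only [Fintype.sum_prod_type, ← sum_mul]
    rw [sum_comm]
    simp only [← sum_mul]
    rfl
  simp only [hsum, shEnt, negMulLog, neg_mul, sum_neg_distrib, sub_neg_eq_add]

lemma shEnt_margX_add_shEnt_le (hp0 : ∀ u, 0 ≤ p u) :
    shEnt (margX p) + shEnt p ≤ shEnt (fun u : Fin a × Fin b => margXY p u.1 u.2) +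
      shEnt (fun u : Fin a × Fin c => margXZ p u.1 u.2) := by
  simp only [shEnt, Fintype.sum_prod_type, ← sum_add_distrib]
  exact sum_le_sum fun x _ =>
    negMulLog_sum_add_sum_negMulLog_le (fun y z => p (x, y, z)) fun y z => hp0 _

lemma shEnt_margZ_le (hp0 : ∀ u, 0 ≤ p u) :
    shEnt (margZ p) ≤ shEnt (fun u : Fin b × Fin c => margYZ p u.1 u.2) := by
  simp only [shEnt, Fintype.sum_prod_type_right]
  refine sum_le_sum fun z _ => ?_
  have hZ : margZ p z = ∑ y, margYZ p y z := sum_comm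
  rw [hZ]
  exact negMulLog_sum_le _ fun y => margYZ_nonneg hp0 y z

end Marginals

/-- The key inequality `I(X;Z) ≤ H(Y) + I(X;Z|Y)` (corrected form of the paper's
`I(θ;S) ≤ H(M) + ε` with `ε = I(θ;S|M)`): for a probability vector `p` on
`Fin a × Fin b × Fin c` with coordinates `(X, Y, Z)` and `Y`-marginal `pY`. -/
theorem stmt_11 (a b c : ℕ) (p : Fin a × Fin b × Fin c → ℝ)
    (hp0 : ∀ x, 0 ≤ p x) (hp1 : ∑ x, p x = 1) :
    miX_Z p ≤ shEnt (margY p) + condMI_XZgY p := by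
  rw [miX_Z, condMI_XZgY, condEntXgY_eq hp0, condEntZgY_eq hp0, condEntXZgY_eq hp0]
  linarith [shEnt_margX_add_shEnt_le hp0, shEnt_margZ_le hp0]
end

section
/- Let p and q be probability vectors on Fin n with q x > 0 whenever p x > 0, and let f : Fin n → ℝ. Then the change-of-measure (Donsker–Varadhan) inequality holds: ∑ x, p x * f x ≤ Real.log (∑ x, q x * Real.exp (f x)) + KL(p‖q). -/
open scoped Classical

/-- Pointwise form of the change-of-measure inequality: `log t ≤ t - 1` at `t = b * exp y / (Z * a)`,
multiplied by `a`. -/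
theorem mul_le_mul_log_add_mul_log_div_add {a b y Z : ℝ} (ha : 0 < a) (hb : 0 < b) (hZ : 0 < Z) :
    a * y ≤ a * Real.log Z + a * Real.log (a / b) + (b * Real.exp y / Z - a) := by
  have hlog := Real.log_le_sub_one_of_pos (x := b * Real.exp y / (Z * a)) (by positivity)
  rw [Real.log_div (by positivity) (by positivity), Real.log_mul hb.ne' (Real.exp_ne_zero y),
    Real.log_mul hZ.ne' ha.ne', Real.log_exp] at hlog
  rw [Real.log_div ha.ne' hb.ne']
  have hmul := mul_le_mul_of_nonneg_left hlog ha.le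
  have hcancel : a * (b * Real.exp y / (Z * a) - 1) = b * Real.exp y / Z - a := by
    field_simp
  linarith

/-- Change-of-measure (Donsker–Varadhan) inequality: for probability vectors
`p, q` on `Fin n` with `q x > 0` whenever `p x > 0`, and any `f : Fin n → ℝ`,
`∑ x, p x * f x ≤ log (∑ x, q x * exp (f x)) + KL(p‖q)`. -/
theorem stmt_13 (n : ℕ) (p q : Fin n → ℝ)
    (hp0 : ∀ x, 0 ≤ p x) (hp1 : ∑ x, p x = 1)
    (hq0 : ∀ x, 0 ≤ q x) (hq1 : ∑ x, q x = 1)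
    (habs : ∀ x, 0 < p x → 0 < q x) (f : Fin n → ℝ) :
    ∑ x, p x * f x ≤
      Real.log (∑ x, q x * Real.exp (f x)) +
        ∑ x ∈ Finset.univ.filter (fun x => 0 < p x), p x * Real.log (p x / q x) := by
  set Z := ∑ x, q x * Real.exp (f x) with hZdef
  have hZ : 0 < Z := by
    obtain ⟨x, -, hx⟩ : ∃ x ∈ Finset.univ, 0 < q x :=
      Finset.exists_lt_of_sum_lt (by simp [hq1])
    exact Finset.sum_pos' (fun i _ => mul_nonneg (hq0 i) (Real.exp_nonneg _))
      ⟨x, Finset.mem_univ x, mul_pos hx (Real.exp_pos _)⟩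
  rw [Finset.sum_filter]
  calc ∑ x, p x * f x
      ≤ ∑ x, (p x * Real.log Z + (if 0 < p x then p x * Real.log (p x / q x) else 0) +
          (q x * Real.exp (f x) / Z - p x)) := by
        refine Finset.sum_le_sum fun x _ => ?_
        rcases (hp0 x).eq_or_lt with hx | hx
        · have := div_nonneg (mul_nonneg (hq0 x) (Real.exp_nonneg (f x))) hZ.le
          simpa [← hx] using this
        · rw [if_pos hx]
          exact mul_le_mul_log_add_mul_log_div_add hx (habs x hx) hZ
    _ = Real.log Z + ∑ x, (if 0 < p x then p x * Real.log (p x / q x) else 0) := by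
        rw [Finset.sum_add_distrib, Finset.sum_add_distrib, Finset.sum_sub_distrib,
          ← Finset.sum_mul, ← Finset.sum_div, ← hZdef, hp1, div_self hZ.ne']
        ring
end

section
/- Let p and q be probability vectors on Fin n with q x > 0 whenever p x > 0, let f : Fin n → ℝ, and let σ ≥ 0. Suppose f is σ-sub-Gaussian under q, i.e., for all λ : ℝ, ∑ x, q x * Real.exp (λ * (f x − E_q f)) ≤ Real.exp (λ^2 * σ^2 / 2), where E_q f = ∑ x, q x * f x. Then the transportation inequality holds: |∑ x, p x * f x − ∑ x, q x * f x| ≤ Real.sqrt (2 * σ^2 * KL(p‖q)). -/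
open scoped Classical

/-- The Gibbs variational inequality: if `∑ x, q x * exp (g x) ≤ exp c`, then
`E_p g ≤ KL(p‖q) + c`. -/
theorem sum_mul_le_kl_add_of_sum_mul_exp_le {ι : Type*} [Fintype ι] (p q g : ι → ℝ) (c : ℝ)
    (hp0 : ∀ x, 0 ≤ p x) (hp1 : ∑ x, p x = 1) (hq0 : ∀ x, 0 ≤ q x)
    (habs : ∀ x, 0 < p x → 0 < q x)
    (hg : ∑ x, q x * Real.exp (g x) ≤ Real.exp c) :
    ∑ x, p x * g x ≤
      ∑ x ∈ Finset.univ.filter (fun x => 0 < p x), p x * Real.log (p x / q x) + c := by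
  have hpt : ∀ x, p x * g x - p x * c - (if 0 < p x then p x * Real.log (p x / q x) else 0) ≤
      q x * Real.exp (g x) * Real.exp (-c) - p x := by
    intro x
    split_ifs with hx
    · have hqx := habs x hx
      have hlog := Real.add_one_le_exp (g x + -c - Real.log (p x / q x))
      rw [Real.exp_sub, Real.exp_add, Real.exp_log (div_pos hx hqx)] at hlog
      have hmul := mul_le_mul_of_nonneg_left hlog hx.le
      have hcancel : p x * (Real.exp (g x) * Real.exp (-c) / (p x / q x)) =
          q x * Real.exp (g x) * Real.exp (-c) := by
        field_simp
      rw [hcancel] at hmul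
      linarith
    · have hpx : p x = 0 := le_antisymm (not_lt.mp hx) (hp0 x)
      have := hq0 x
      simp only [hpx]
      ring_nf
      positivity
  have hsum := Finset.sum_le_sum fun x (_ : x ∈ Finset.univ) => hpt x
  simp only [Finset.sum_sub_distrib, ← Finset.sum_mul, hp1, ← Finset.sum_filter] at hsum
  have hexp := mul_le_mul_of_nonneg_right hg (Real.exp_pos (-c)).le
  rw [← Real.exp_add, add_neg_cancel, Real.exp_zero] at hexp
  linarith

/-- Transportation inequality for sub-Gaussian functions: if `p, q` are probability
vectors on `Fin n` with `q x > 0` whenever `p x > 0`, and `f : Fin n → ℝ` is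
`σ`-sub-Gaussian under `q` (i.e. `∑ x, q x * exp (λ * (f x − E_q f)) ≤ exp (λ² σ² / 2)`
for all `λ`), then `|E_p f − E_q f| ≤ √(2 σ² KL(p‖q))`. -/
theorem stmt_14 (n : ℕ) (p q : Fin n → ℝ)
    (hp0 : ∀ x, 0 ≤ p x) (hp1 : ∑ x, p x = 1)
    (hq0 : ∀ x, 0 ≤ q x) (hq1 : ∑ x, q x = 1)
    (habs : ∀ x, 0 < p x → 0 < q x) (f : Fin n → ℝ) (σ : ℝ) (hσ : 0 ≤ σ)
    (hsub : ∀ lam : ℝ,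
      ∑ x, q x * Real.exp (lam * (f x - ∑ y, q y * f y)) ≤
        Real.exp (lam ^ 2 * σ ^ 2 / 2)) :
    |∑ x, p x * f x - ∑ x, q x * f x| ≤
      Real.sqrt (2 * σ ^ 2 *
        ∑ x ∈ Finset.univ.filter (fun x => 0 < p x), p x * Real.log (p x / q x)) := by
  set K := ∑ x ∈ Finset.univ.filter (fun x => 0 < p x), p x * Real.log (p x / q x)
  set m := ∑ x, q x * f x
  have hlin : ∀ lam : ℝ, ∑ x, p x * (lam * (f x - m)) = lam * (∑ x, p x * f x - m) := by
    intro lam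
    calc ∑ x, p x * (lam * (f x - m)) = ∑ x, (lam * (p x * f x) - p x * (lam * m)) :=
          Finset.sum_congr rfl fun x _ => by ring
      _ = lam * (∑ x, p x * f x - m) := by
          rw [Finset.sum_sub_distrib, ← Finset.mul_sum, ← Finset.sum_mul, hp1]
          ring
  have hquad : ∀ lam : ℝ,
      0 ≤ σ ^ 2 / 2 * (lam * lam) + -(∑ x, p x * f x - m) * lam + K := by
    intro lam
    have h := sum_mul_le_kl_add_of_sum_mul_exp_le p q _ _ hp0 hp1 hq0 habs (hsub lam)
    rw [hlin] at h
    linarith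
  have hdisc := discrim_le_zero hquad
  rw [discrim] at hdisc
  apply Real.abs_le_sqrt
  linarith
end

section
/- Let μ be a probability vector on Fin m × Fin n with marginals μX and μY, and let π (i, j) = μX i * μY j be the product of the marginals. Let g : Fin m × Fin n → ℝ and σ ≥ 0 be such that for all λ : ℝ, ∑ (i, j), π (i, j) * Real.exp (λ * (g (i, j) − E_π g)) ≤ Real.exp (λ^2 * σ^2 / 2), where E_π g = ∑ (i, j), π (i, j) * g (i, j). Then the mutual-information decoupling bound holds: |∑ (i, j), μ (i, j) * g (i, j) − ∑ (i, j), π (i, j) * g (i, j)| ≤ Real.sqrt (2 * σ^2 * I(μ)), where I(μ) = H(μX) + H(μY) − H(μ). (This is the core estimate behind the paper's Corollary on the generalization bound.) -/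
/-- First marginal of a probability vector on `Fin m × Fin n`. -/
noncomputable def margFst {m n : ℕ} (μ : Fin m × Fin n → ℝ) (i : Fin m) : ℝ :=
  ∑ j, μ (i, j)

/-- Second marginal of a probability vector on `Fin m × Fin n`. -/
noncomputable def margSnd {m n : ℕ} (μ : Fin m × Fin n → ℝ) (j : Fin n) : ℝ :=
  ∑ i, μ (i, j)

/-- Product of the marginals `π (i, j) = μX i * μY j`. -/
noncomputable def prodMarg {m n : ℕ} (μ : Fin m × Fin n → ℝ) (x : Fin m × Fin n) : ℝ :=
  margFst μ x.1 * margSnd μ x.2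

/-- Mutual information `I(μ) = H(μX) + H(μY) − H(μ)`. -/
noncomputable def mutInfo {m n : ℕ} (μ : Fin m × Fin n → ℝ) : ℝ :=
  (∑ i, Real.negMulLog (margFst μ i)) + (∑ j, Real.negMulLog (margSnd μ j))
    - ∑ x, Real.negMulLog (μ x)

/-- Fenchel–Young inequality for the pair of the relative entropy and the exponential. -/
lemma mul_le_mul_log_sub_log_add_mul_exp {p q : ℝ} (hp : 0 ≤ p) (hq : 0 ≤ q)
    (hpq : 0 < p → 0 < q) (t : ℝ) :
    p * t ≤ p * (Real.log p - Real.log q) - p + q * Real.exp t := by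
  rcases hp.eq_or_lt with rfl | hp
  · simpa using mul_nonneg hq (Real.exp_pos t).le
  · have hq' := hpq hp
    have h := mul_le_mul_of_nonneg_left
      (Real.add_one_le_exp (t + Real.log q - Real.log p)) hp.le
    have h' : p * Real.exp (t + Real.log q - Real.log p) = q * Real.exp t := by
      rw [Real.exp_sub, Real.exp_add, Real.exp_log hp, Real.exp_log hq']
      field_simp
    linarith

/-- Weak Donsker–Varadhan inequality on a finite type. -/
lemma sum_mul_le_relEntropy_of_sum_mul_exp_le_one {α : Type*} [Fintype α] {p q : α → ℝ}
    (hp : ∀ x, 0 ≤ p x) (hp1 : ∑ x, p x = 1) (hq : ∀ x, 0 ≤ q x)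
    (hpq : ∀ x, 0 < p x → 0 < q x) {f : α → ℝ} (hf : ∑ x, q x * Real.exp (f x) ≤ 1) :
    ∑ x, p x * f x ≤ ∑ x, p x * (Real.log (p x) - Real.log (q x)) := by
  have h := Finset.sum_le_sum fun x (_ : x ∈ Finset.univ) =>
    mul_le_mul_log_sub_log_add_mul_exp (hp x) (hq x) (hpq x) (f x)
  rw [Finset.sum_add_distrib, Finset.sum_sub_distrib] at h
  linarith

/-- Transport inequality for sub-Gaussian functions on a finite type. -/
lemma abs_sum_mul_sub_le_sqrt_relEntropy {α : Type*} [Fintype α] {p q : α → ℝ}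
    (hp : ∀ x, 0 ≤ p x) (hp1 : ∑ x, p x = 1) (hq : ∀ x, 0 ≤ q x)
    (hpq : ∀ x, 0 < p x → 0 < q x) {g : α → ℝ} {c σ : ℝ}
    (hsub : ∀ t : ℝ, ∑ x, q x * Real.exp (t * (g x - c)) ≤ Real.exp (t ^ 2 * σ ^ 2 / 2)) :
    |∑ x, p x * g x - c| ≤
      Real.sqrt (2 * σ ^ 2 * ∑ x, p x * (Real.log (p x) - Real.log (q x))) := by
  have key (t : ℝ) : 0 ≤ σ ^ 2 / 2 * (t * t) + -(∑ x, p x * g x - c) * t +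
      ∑ x, p x * (Real.log (p x) - Real.log (q x)) := by
    have h := sum_mul_le_relEntropy_of_sum_mul_exp_le_one hp hp1 hq hpq
      (f := fun x => t * (g x - c) - t ^ 2 * σ ^ 2 / 2) (by
        simp_rw [Real.exp_sub, ← mul_div_assoc]
        rw [← Finset.sum_div]
        exact div_le_one_of_le₀ (hsub t) (Real.exp_pos _).le)
    have hsum : ∑ x, p x * (t * (g x - c) - t ^ 2 * σ ^ 2 / 2) =
        t * ∑ x, p x * g x - (t * c + t ^ 2 * σ ^ 2 / 2) * ∑ x, p x := by
      rw [Finset.mul_sum, Finset.mul_sum, ← Finset.sum_sub_distrib]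
      exact Finset.sum_congr rfl fun x _ => by ring
    rw [hsum, hp1] at h
    linarith
  have hd := discrim_le_zero key
  rw [discrim] at hd
  exact Real.abs_le_sqrt (by linarith)

lemma le_margFst {m n : ℕ} {μ : Fin m × Fin n → ℝ} (hμ : ∀ x, 0 ≤ μ x) (x : Fin m × Fin n) :
    μ x ≤ margFst μ x.1 :=
  Finset.single_le_sum (f := fun j => μ (x.1, j)) (fun _ _ => hμ _) (Finset.mem_univ x.2)

lemma le_margSnd {m n : ℕ} {μ : Fin m × Fin n → ℝ} (hμ : ∀ x, 0 ≤ μ x) (x : Fin m × Fin n) :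
    μ x ≤ margSnd μ x.2 :=
  Finset.single_le_sum (f := fun i => μ (i, x.2)) (fun _ _ => hμ _) (Finset.mem_univ x.1)

lemma prodMarg_nonneg {m n : ℕ} {μ : Fin m × Fin n → ℝ} (hμ : ∀ x, 0 ≤ μ x)
    (x : Fin m × Fin n) : 0 ≤ prodMarg μ x :=
  mul_nonneg ((hμ x).trans (le_margFst hμ x)) ((hμ x).trans (le_margSnd hμ x))

lemma prodMarg_pos {m n : ℕ} {μ : Fin m × Fin n → ℝ} (hμ : ∀ x, 0 ≤ μ x)
    {x : Fin m × Fin n} (hx : 0 < μ x) : 0 < prodMarg μ x :=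
  mul_pos (hx.trans_le (le_margFst hμ x)) (hx.trans_le (le_margSnd hμ x))

lemma sum_mul_fst {m n : ℕ} (μ : Fin m × Fin n → ℝ) (f : Fin m → ℝ) :
    ∑ x, μ x * f x.1 = ∑ i, margFst μ i * f i := by
  simp_rw [Fintype.sum_prod_type, margFst, Finset.sum_mul]

lemma sum_mul_snd {m n : ℕ} (μ : Fin m × Fin n → ℝ) (f : Fin n → ℝ) :
    ∑ x, μ x * f x.2 = ∑ j, margSnd μ j * f j := by
  simp_rw [Fintype.sum_prod_type_right, margSnd, Finset.sum_mul]

/-- Mutual information is the relative entropy of the joint law with respect to the product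
of its marginals. -/
lemma mutInfo_eq_relEntropy {m n : ℕ} {μ : Fin m × Fin n → ℝ} (hμ : ∀ x, 0 ≤ μ x) :
    mutInfo μ = ∑ x, μ x * (Real.log (μ x) - Real.log (prodMarg μ x)) := by
  have h (x : Fin m × Fin n) : μ x * (Real.log (μ x) - Real.log (prodMarg μ x)) =
      μ x * Real.log (μ x) - μ x * Real.log (margFst μ x.1) -
        μ x * Real.log (margSnd μ x.2) := by
    rcases (hμ x).eq_or_lt with hx | hx
    · simp [← hx]
    · rw [prodMarg, Real.log_mul (hx.trans_le (le_margFst hμ x)).ne'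
        (hx.trans_le (le_margSnd hμ x)).ne']
      ring
  simp_rw [h, Finset.sum_sub_distrib, sum_mul_fst μ fun i => Real.log (margFst μ i),
    sum_mul_snd μ fun j => Real.log (margSnd μ j), mutInfo, Real.negMulLog, neg_mul,
    Finset.sum_neg_distrib]
  ring

/-- Mutual-information decoupling bound: if `μ` is a probability vector on
`Fin m × Fin n` with product-of-marginals `π`, and `g` is `σ`-sub-Gaussian under `π`,
then `|E_μ g − E_π g| ≤ √(2 σ² I(μ))`. -/
theorem stmt_15 (m n : ℕ) (μ : Fin m × Fin n → ℝ)
    (hμ0 : ∀ x, 0 ≤ μ x) (hμ1 : ∑ x, μ x = 1)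
    (g : Fin m × Fin n → ℝ) (σ : ℝ) (hσ : 0 ≤ σ)
    (hsub : ∀ lam : ℝ,
      ∑ x, prodMarg μ x * Real.exp (lam * (g x - ∑ y, prodMarg μ y * g y)) ≤
        Real.exp (lam ^ 2 * σ ^ 2 / 2)) :
    |∑ x, μ x * g x - ∑ x, prodMarg μ x * g x| ≤
      Real.sqrt (2 * σ ^ 2 * mutInfo μ) := by
  rw [mutInfo_eq_relEntropy hμ0]
  exact abs_sum_mul_sub_le_sqrt_relEntropy hμ0 hμ1 (prodMarg_nonneg hμ0)
    (fun _ => prodMarg_pos hμ0) hsub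
end

section
/- Let ν be a probability vector on Fin a × Fin b × Fin c with coordinates (θ, M, S), let n ≥ 1 be a natural number, and write νθ, νM, νS for the single-coordinate marginals, νθS for the (θ, S)-marginal, and π (x, z) = νθ x * νS z for the product of the θ- and S-marginals. Suppose g : Fin a × Fin c → ℝ satisfies, for all λ : ℝ, ∑ (x, z), π (x, z) * Real.exp (λ * (g (x, z) − E_π g)) ≤ Real.exp (λ^2 / (2 * n)) (i.e., g is sub-Gaussian with variance proxy σ^2 = 1/n under π). Set δ = H(νM) and ε = I(θ;S|M) computed from ν. Then |∑ (x, z), νθS (x, z) * g (x, z) − ∑ (x, z), π (x, z) * g (x, z)| ≤ Real.sqrt (2 * (δ + ε) / n). (This is the paper's Corollary on the generalization bound: the expected generalization gap is at most √(2(δ+ε)/n), where δ is the entropy of the reconfigured shared manifold variable M and ε is the residual conditional mutual information I(θ;S|M).) -/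
open scoped Classical

/-- `θ`-marginal of a probability vector on `Fin a × Fin b × Fin c` with coordinates `(θ, M, S)`. -/
noncomputable def margTheta {a b c : ℕ} (ν : Fin a × Fin b × Fin c → ℝ) (x : Fin a) : ℝ :=
  ∑ y, ∑ z, ν (x, y, z)

/-- `M`-marginal. -/
noncomputable def margM {a b c : ℕ} (ν : Fin a × Fin b × Fin c → ℝ) (y : Fin b) : ℝ :=
  ∑ x, ∑ z, ν (x, y, z)

/-- `S`-marginal. -/
noncomputable def margS {a b c : ℕ} (ν : Fin a × Fin b × Fin c → ℝ) (z : Fin c) : ℝ :=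
  ∑ x, ∑ y, ν (x, y, z)

/-- `(θ, M)`-marginal. -/
noncomputable def margThetaM {a b c : ℕ} (ν : Fin a × Fin b × Fin c → ℝ)
    (x : Fin a) (y : Fin b) : ℝ :=
  ∑ z, ν (x, y, z)

/-- `(M, S)`-marginal. -/
noncomputable def margMS {a b c : ℕ} (ν : Fin a × Fin b × Fin c → ℝ)
    (y : Fin b) (z : Fin c) : ℝ :=
  ∑ x, ν (x, y, z)

/-- `(θ, S)`-marginal. -/
noncomputable def margThetaS {a b c : ℕ} (ν : Fin a × Fin b × Fin c → ℝ)
    (u : Fin a × Fin c) : ℝ :=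
  ∑ y, ν (u.1, y, u.2)

/-- Product of the `θ`- and `S`-marginals, `π (x, z) = νθ x * νS z`. -/
noncomputable def prodThetaS {a b c : ℕ} (ν : Fin a × Fin b × Fin c → ℝ)
    (u : Fin a × Fin c) : ℝ :=
  margTheta ν u.1 * margS ν u.2

/-- Shannon entropy `H(νM)` of the `M`-marginal. -/
noncomputable def entM {a b c : ℕ} (ν : Fin a × Fin b × Fin c → ℝ) : ℝ :=
  ∑ y, Real.negMulLog (margM ν y)

/-- Conditional entropy `H(θ|M)`. -/
noncomputable def condEntThetaM {a b c : ℕ} (ν : Fin a × Fin b × Fin c → ℝ) : ℝ :=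
  ∑ u ∈ Finset.univ.filter (fun u : Fin a × Fin b => 0 < margThetaM ν u.1 u.2),
    margThetaM ν u.1 u.2 * Real.log (margM ν u.2 / margThetaM ν u.1 u.2)

/-- Conditional entropy `H(S|M)`. -/
noncomputable def condEntSM {a b c : ℕ} (ν : Fin a × Fin b × Fin c → ℝ) : ℝ :=
  ∑ u ∈ Finset.univ.filter (fun u : Fin b × Fin c => 0 < margMS ν u.1 u.2),
    margMS ν u.1 u.2 * Real.log (margM ν u.1 / margMS ν u.1 u.2)

/-- Conditional joint entropy `H(θ,S|M)`. -/
noncomputable def condEntThetaSM {a b c : ℕ} (ν : Fin a × Fin b × Fin c → ℝ) : ℝ :=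
  ∑ u ∈ Finset.univ.filter (fun u : Fin a × Fin b × Fin c => 0 < ν u),
    ν u * Real.log (margM ν u.2.1 / ν u)

/-- Conditional mutual information `I(θ;S|M) = H(θ|M) + H(S|M) − H(θ,S|M)`. -/
noncomputable def condMIThetaSM {a b c : ℕ} (ν : Fin a × Fin b × Fin c → ℝ) : ℝ :=
  condEntThetaM ν + condEntSM ν - condEntThetaSM ν

section GeneralizationBound

variable {a b c : ℕ} {ν : Fin a × Fin b × Fin c → ℝ}

lemma le_margThetaM (hν : ∀ u, 0 ≤ ν u) (x : Fin a) (y : Fin b) (z : Fin c) :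
    ν (x, y, z) ≤ margThetaM ν x y :=
  Finset.single_le_sum (f := fun z => ν (x, y, z)) (fun _ _ => hν _) (Finset.mem_univ z)

lemma le_margMS (hν : ∀ u, 0 ≤ ν u) (x : Fin a) (y : Fin b) (z : Fin c) :
    ν (x, y, z) ≤ margMS ν y z :=
  Finset.single_le_sum (f := fun x => ν (x, y, z)) (fun _ _ => hν _) (Finset.mem_univ x)

lemma margThetaM_nonneg (hν : ∀ u, 0 ≤ ν u) (x : Fin a) (y : Fin b) : 0 ≤ margThetaM ν x y :=
  Finset.sum_nonneg fun _ _ => hν _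

lemma margMS_nonneg (hν : ∀ u, 0 ≤ ν u) (y : Fin b) (z : Fin c) : 0 ≤ margMS ν y z :=
  Finset.sum_nonneg fun _ _ => hν _

lemma margM_eq_sum_margMS (y : Fin b) : margM ν y = ∑ z, margMS ν y z :=
  Finset.sum_comm

lemma margThetaM_le_margM (hν : ∀ u, 0 ≤ ν u) (x : Fin a) (y : Fin b) :
    margThetaM ν x y ≤ margM ν y :=
  Finset.single_le_sum (f := fun x => margThetaM ν x y) (fun _ _ => margThetaM_nonneg hν _ _)
    (Finset.mem_univ x)

lemma margMS_le_margM (hν : ∀ u, 0 ≤ ν u) (y : Fin b) (z : Fin c) :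
    margMS ν y z ≤ margM ν y := by
  rw [margM_eq_sum_margMS]
  exact Finset.single_le_sum (f := fun z => margMS ν y z) (fun _ _ => margMS_nonneg hν _ _)
    (Finset.mem_univ z)

lemma sum_margThetaM_mul_margMS_le (hν : ∀ u, 0 ≤ ν u) (x : Fin a) (z : Fin c) :
    ∑ y, margThetaM ν x y * margMS ν y z ≤ prodThetaS ν (x, z) := by
  have hS : ∀ y, margMS ν y z ≤ margS ν z := fun y => by
    have : margS ν z = ∑ y, margMS ν y z := Finset.sum_comm
    rw [this]
    exact Finset.single_le_sum (f := fun y => margMS ν y z) (fun _ _ => margMS_nonneg hν _ _)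
      (Finset.mem_univ y)
  calc ∑ y, margThetaM ν x y * margMS ν y z ≤ ∑ y, margThetaM ν x y * margS ν z :=
        Finset.sum_le_sum fun y _ =>
          mul_le_mul_of_nonneg_left (hS y) (margThetaM_nonneg hν x y)
    _ = prodThetaS ν (x, z) := by rw [← Finset.sum_mul]; rfl

lemma sum_filter_pos_mul_log_div {α : Type*} [Fintype α] {f g : α → ℝ}
    (hf : ∀ u, 0 ≤ f u) (hfg : ∀ u, f u ≤ g u) :
    ∑ u ∈ Finset.univ.filter (fun u => 0 < f u), f u * Real.log (g u / f u) =
      ∑ u, f u * (Real.log (g u) - Real.log (f u)) := by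
  rw [Finset.sum_filter]
  refine Finset.sum_congr rfl fun u _ => ?_
  split_ifs with h
  · rw [Real.log_div (h.trans_le (hfg u)).ne' h.ne']
  · rw [le_antisymm (not_lt.1 h) (hf u), zero_mul]

lemma entM_add_condMIThetaSM (hν : ∀ u, 0 ≤ ν u) :
    entM ν + condMIThetaSM ν = ∑ x, ∑ y, ∑ z, ν (x, y, z) *
      (Real.log (ν (x, y, z)) - Real.log (margThetaM ν x y) - Real.log (margMS ν y z)) := by
  have hM : entM ν = ∑ x, ∑ y, ∑ z, ν (x, y, z) * -Real.log (margM ν y) := by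
    rw [Finset.sum_comm]
    refine Finset.sum_congr rfl fun y _ => ?_
    simp_rw [← Finset.sum_mul]
    rw [Real.negMulLog, neg_mul, mul_neg]
    rfl
  have hTM : condEntThetaM ν = ∑ x, ∑ y, ∑ z, ν (x, y, z) *
      (Real.log (margM ν y) - Real.log (margThetaM ν x y)) := by
    unfold condEntThetaM
    rw [sum_filter_pos_mul_log_div (f := fun u : Fin a × Fin b => margThetaM ν u.1 u.2)
      (g := fun u => margM ν u.2) (fun u => margThetaM_nonneg hν _ _)
      (fun u => margThetaM_le_margM hν _ _), Fintype.sum_prod_type]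
    simp_rw [← Finset.sum_mul]
    rfl
  have hMS : condEntSM ν = ∑ x, ∑ y, ∑ z, ν (x, y, z) *
      (Real.log (margM ν y) - Real.log (margMS ν y z)) := by
    unfold condEntSM
    rw [sum_filter_pos_mul_log_div (f := fun u : Fin b × Fin c => margMS ν u.1 u.2)
      (g := fun u => margM ν u.1) (fun u => margMS_nonneg hν _ _)
      (fun u => margMS_le_margM hν _ _), Fintype.sum_prod_type, Finset.sum_comm (γ := Fin a)]
    refine Finset.sum_congr rfl fun y _ => ?_
    rw [Finset.sum_comm]
    simp_rw [← Finset.sum_mul]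
    rfl
  have hTMS : condEntThetaSM ν = ∑ x, ∑ y, ∑ z, ν (x, y, z) *
      (Real.log (margM ν y) - Real.log (ν (x, y, z))) := by
    unfold condEntThetaSM
    rw [sum_filter_pos_mul_log_div (f := ν) (g := fun u => margM ν u.2.1) hν
      (fun u => (le_margThetaM hν _ _ _).trans (margThetaM_le_margM hν _ _))]
    simp_rw [Fintype.sum_prod_type]
  rw [condMIThetaSM, hM, hTM, hMS, hTMS]
  simp_rw [← Finset.sum_add_distrib, ← Finset.sum_sub_distrib, ← Finset.sum_add_distrib]
  refine Finset.sum_congr rfl fun x _ => Finset.sum_congr rfl fun y _ =>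
    Finset.sum_congr rfl fun z _ => ?_
  ring

/-- Pointwise Gibbs inequality, from `log t ≤ t - 1` with `t = exp h * q * r / p`. -/
lemma mul_sub_log_le {p q r h : ℝ} (hp : 0 ≤ p) (hq : p ≤ q) (hr : p ≤ r) :
    p * (h - (Real.log p - Real.log q - Real.log r)) ≤ q * r * Real.exp h - p := by
  rcases hp.eq_or_lt with rfl | hp
  · simpa using mul_nonneg (mul_nonneg hq hr) (Real.exp_pos h).le
  have hq' := hp.trans_le hq
  have hr' := hp.trans_le hr
  have key := Real.log_le_sub_one_of_pos (x := q * r * Real.exp h / p) (by positivity)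
  rw [Real.log_div (by positivity) hp.ne', Real.log_mul (by positivity) (Real.exp_pos h).ne',
    Real.log_mul hq'.ne' hr'.ne', Real.log_exp] at key
  calc p * (h - (Real.log p - Real.log q - Real.log r))
      = p * (Real.log q + Real.log r + h - Real.log p) := by ring
    _ ≤ p * (q * r * Real.exp h / p - 1) := mul_le_mul_of_nonneg_left key hp.le
    _ = q * r * Real.exp h - p := by field_simp

/-- Donsker–Varadhan type bound: if `exp h` has mean at most one under the product of the
marginals, the mean of `h` under the joint law of `(θ, S)` is at most `H(M) + I(θ;S|M)`. -/
lemma sum_margThetaS_mul_le (hν : ∀ u, 0 ≤ ν u) (hν1 : ∑ u, ν u = 1) (h : Fin a × Fin c → ℝ)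
    (hexp : ∑ u, prodThetaS ν u * Real.exp (h u) ≤ 1) :
    ∑ u, margThetaS ν u * h u ≤ entM ν + condMIThetaSM ν := by
  have hleft : ∑ u, margThetaS ν u * h u = ∑ x, ∑ y, ∑ z, ν (x, y, z) * h (x, z) := by
    rw [Fintype.sum_prod_type]
    refine Finset.sum_congr rfl fun x _ => ?_
    rw [Finset.sum_comm]
    simp_rw [← Finset.sum_mul]
    rfl
  have hprod : ∑ x, ∑ y, ∑ z, margThetaM ν x y * margMS ν y z * Real.exp (h (x, z)) ≤ 1 := by
    refine le_trans ?_ hexp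
    rw [Fintype.sum_prod_type]
    refine Finset.sum_le_sum fun x _ => ?_
    rw [Finset.sum_comm]
    refine Finset.sum_le_sum fun z _ => ?_
    rw [← Finset.sum_mul]
    exact mul_le_mul_of_nonneg_right (sum_margThetaM_mul_margMS_le hν x z) (Real.exp_pos _).le
  have hone : ∑ x, ∑ y, ∑ z, ν (x, y, z) = 1 := by
    rw [← hν1]
    simp_rw [Fintype.sum_prod_type]
  have hmain := Finset.sum_le_sum fun x (_ : x ∈ Finset.univ) =>
    Finset.sum_le_sum fun y (_ : y ∈ Finset.univ) =>
      Finset.sum_le_sum fun z (_ : z ∈ Finset.univ) =>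
        mul_sub_log_le (h := h (x, z)) (hν (x, y, z)) (le_margThetaM hν x y z)
          (le_margMS hν x y z)
  rw [hleft, entM_add_condMIThetaSM hν]
  simp_rw [mul_sub _ (h _), Finset.sum_sub_distrib] at hmain
  linarith

lemma sum_margThetaS (hν1 : ∑ u, ν u = 1) : ∑ u, margThetaS ν u = 1 := by
  rw [← hν1]
  simp_rw [Fintype.sum_prod_type]
  exact Finset.sum_congr rfl fun x _ => Finset.sum_comm

end GeneralizationBound

/-- The paper's generalization bound: if `ν` is a probability vector on
`Fin a × Fin b × Fin c` with coordinates `(θ, M, S)`, `n ≥ 1`, and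
`g : Fin a × Fin c → ℝ` is sub-Gaussian with variance proxy `1/n` under the product
`π` of the `θ`- and `S`-marginals, then with `δ = H(νM)` and `ε = I(θ;S|M)`,
`|E_{νθS} g − E_π g| ≤ √(2 (δ + ε) / n)`. -/
theorem stmt_16 (a b c : ℕ) (ν : Fin a × Fin b × Fin c → ℝ)
    (hν0 : ∀ x, 0 ≤ ν x) (hν1 : ∑ x, ν x = 1)
    (n : ℕ) (hn : 1 ≤ n) (g : Fin a × Fin c → ℝ)
    (hsub : ∀ lam : ℝ,
      ∑ u, prodThetaS ν u * Real.exp (lam * (g u - ∑ w, prodThetaS ν w * g w)) ≤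
        Real.exp (lam ^ 2 / (2 * (n : ℝ)))) :
    |∑ u, margThetaS ν u * g u - ∑ u, prodThetaS ν u * g u| ≤
      Real.sqrt (2 * (entM ν + condMIThetaSM ν) / (n : ℝ)) := by
  have hn' : (0 : ℝ) < n := by exact_mod_cast hn
  set m := ∑ w, prodThetaS ν w * g w with hm
  set Δ := ∑ u, margThetaS ν u * g u - m with hΔ
  have hmean : ∀ lam : ℝ,
      lam * Δ - lam ^ 2 / (2 * (n : ℝ)) ≤ entM ν + condMIThetaSM ν := fun lam => by
    refine le_of_eq_of_le ?_ (sum_margThetaS_mul_le hν0 hν1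
      (fun u => lam * (g u - m) - lam ^ 2 / (2 * (n : ℝ))) ?_)
    · have hexpand : ∀ u, margThetaS ν u * (lam * (g u - m) - lam ^ 2 / (2 * (n : ℝ))) =
          lam * (margThetaS ν u * g u) -
            margThetaS ν u * (lam * m + lam ^ 2 / (2 * (n : ℝ))) := fun u => by ring
      simp_rw [hexpand]
      rw [Finset.sum_sub_distrib, ← Finset.mul_sum, ← Finset.sum_mul, sum_margThetaS hν1, hΔ]
      ring
    · simp_rw [Real.exp_sub, ← mul_div_assoc]
      rw [← Finset.sum_div]
      exact (div_le_one (Real.exp_pos _)).2 (hsub lam)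
  refine Real.abs_le_sqrt ?_
  rw [le_div_iff₀ hn']
  have hopt := hmean (n * Δ)
  have hval : n * Δ * Δ - (n * Δ) ^ 2 / (2 * (n : ℝ)) = Δ ^ 2 * n / 2 := by
    field_simp
    ring
  linarith
end
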